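/- arXiv:math-ph/0109018 — 3 statements merged into one kernel-verified Lean document; each statement's English description precedes it below -/
import Mathlib

section
/- For every n ∈ ℕ and every x ∈ ℝ, ψ_n'(x) = −(1/2) Σ_{k=1}^{d} ( η_{k,n} ψ_{n+k}(x) − η_{k,n−k} ψ_{n−k}(x) ), where d = deg V − 1 and the terms with n − k < 0 are omitted; here η_{k,j} = ∫_ℝ V'(t) ψ_j(t) ψ_{j+k}(t) dt. -/
open MeasureTheory Polynomial Real

/-- Integration of polynomials against the weight `exp (-V)`, as a linear functional. -/
noncomputable def expWeightFunctional (V : ℝ[X])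
    (hint : ∀ q : ℝ[X], Integrable (fun x : ℝ => q.eval x * Real.exp (-(V.eval x)))) :
    ℝ[X] →ₗ[ℝ] ℝ where
  toFun q := ∫ x : ℝ, q.eval x * Real.exp (-(V.eval x))
  map_add' q r := by
    rw [← integral_add (hint q) (hint r)]
    simp only [eval_add, add_mul]
  map_smul' c q := by
    simp only [eval_smul, smul_eq_mul, mul_assoc, integral_const_mul, RingHom.id_apply]

/-- Integration by parts against the weight `exp (-V)`. -/
theorem expWeightFunctional_derivative (V : ℝ[X])
    (hint : ∀ q : ℝ[X], Integrable (fun x : ℝ => q.eval x * Real.exp (-(V.eval x))))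
    (q : ℝ[X]) :
    expWeightFunctional V hint (derivative q)
      = expWeightFunctional V hint (derivative V * q) := by
  rw [← sub_eq_zero, ← map_sub]
  refine integral_eq_zero_of_hasDerivAt_of_integrable (fun x => ?_)
    (hint (derivative q - derivative V * q)) (hint q)
  refine ((q.hasDerivAt x).mul (V.hasDerivAt x).neg.exp).congr_deriv ?_
  change _ = (derivative q - derivative V * q).eval x * Real.exp (-(V.eval x))
  simp only [eval_sub, eval_mul, Pi.neg_apply]
  ring

/-- A monic sequence with one polynomial in each degree spans the polynomials degree by degree. -/
theorem exists_eq_sum_smul_of_monic {R : Type*} [CommRing R] {p : ℕ → R[X]}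
    (hmonic : ∀ n, (p n).Monic) (hpdeg : ∀ n, (p n).natDegree = n) (N : ℕ) (q : R[X])
    (hq : q.degree < N) : ∃ c : ℕ → R, q = ∑ i ∈ Finset.range N, c i • p i := by
  induction N generalizing q with
  | zero =>
    refine ⟨0, ?_⟩
    have : q = 0 := by simpa using hq
    simp [this]
  | succ N ih =>
    have hlt : (q - q.coeff N • p N).degree < N := by
      rw [degree_lt_iff_coeff_zero] at hq ⊢
      intro m hm
      rcases hm.eq_or_lt with rfl | hm
      · have : (p N).coeff N = 1 := by simpa [hpdeg] using (hmonic N).coeff_natDegree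
        simp [this]
      · have : (p N).coeff m = 0 := coeff_eq_zero_of_natDegree_lt (by rw [hpdeg]; exact hm)
        simp [this, hq m hm]
    obtain ⟨c, hc⟩ := ih _ hlt
    refine ⟨fun i => if i = N then q.coeff N else c i, ?_⟩
    simp only [Finset.sum_range_succ, if_true]
    rw [← sub_eq_iff_eq_add, hc]
    refine Finset.sum_congr rfl fun i hi => ?_
    rw [if_neg (Finset.mem_range.1 hi).ne]

/-- A monic orthogonal sequence is orthogonal to all polynomials of lower degree. -/
theorem map_mul_eq_zero_of_degree_lt {R : Type*} [CommRing R] {p : ℕ → R[X]}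
    (hmonic : ∀ n, (p n).Monic) (hpdeg : ∀ n, (p n).natDegree = n) (L : R[X] →ₗ[R] R)
    (horth : ∀ n m, n ≠ m → L (p n * p m) = 0) (m : ℕ) (q : R[X]) (hq : q.degree < m) :
    L (q * p m) = 0 := by
  obtain ⟨c, rfl⟩ := exists_eq_sum_smul_of_monic hmonic hpdeg m q hq
  simp only [Finset.sum_mul, smul_mul_assoc, map_sum, map_smul]
  refine Finset.sum_eq_zero fun i hi => ?_
  rw [horth i m (Finset.mem_range.1 hi).ne, smul_zero]

/-- The expansion of a polynomial in a monic orthogonal sequence. -/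
theorem eq_sum_div_smul_of_degree_lt {K : Type*} [Field K] {p : ℕ → K[X]}
    (hmonic : ∀ n, (p n).Monic) (hpdeg : ∀ n, (p n).natDegree = n) (L : K[X] →ₗ[K] K)
    (horth : ∀ n m, n ≠ m → L (p n * p m) = 0) (hne : ∀ n, L (p n * p n) ≠ 0)
    (N : ℕ) (q : K[X]) (hq : q.degree < N) :
    q = ∑ i ∈ Finset.range N, (L (q * p i) / L (p i * p i)) • p i := by
  obtain ⟨c, hc⟩ := exists_eq_sum_smul_of_monic hmonic hpdeg N q hq
  have key : ∀ i ∈ Finset.range N, L (q * p i) = c i * L (p i * p i) := by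
    intro i hi
    rw [hc]
    simp only [Finset.sum_mul, smul_mul_assoc, map_sum, map_smul, smul_eq_mul]
    refine Finset.sum_eq_single_of_mem i hi fun j _ hj => ?_
    rw [horth j i hj, mul_zero]
  conv_lhs => rw [hc]
  refine Finset.sum_congr rfl fun i hi => ?_
  rw [key i hi, mul_div_cancel_right₀ _ (hne i)]

/-- A sum over a band around `n`, with vanishing central term, folded about `n`. -/
theorem sum_range_eq_sum_Icc_fold {M : Type*} [AddCommMonoid M] (g : ℕ → M) (n d : ℕ)
    (hn : g n = 0) (hlow : ∀ m, m + d < n → g m = 0) :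
    ∑ m ∈ Finset.range (n + (d + 1)), g m
      = ∑ k ∈ Finset.Icc 1 d, (g (n + k) + if k ≤ n then g (n - k) else 0) := by
  rw [Finset.sum_range_add, Finset.sum_add_distrib, add_comm]
  congr 1
  · rw [Finset.sum_range_succ', add_zero, hn, add_zero, ← Finset.Ico_add_one_right_eq_Icc,
      Finset.sum_Ico_eq_sum_range, Nat.add_sub_cancel]
    exact Finset.sum_congr rfl fun i _ => by rw [add_comm 1 i]
  · rw [← Finset.sum_filter]
    symm
    refine Finset.sum_of_injOn (fun k => n - k) ?_ ?_ ?_ ?_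
    · intro a ha b hb hab
      simp only [Finset.coe_filter, Finset.mem_Icc, Set.mem_ofPred_eq] at ha hb hab
      omega
    · intro a ha
      simp only [Finset.coe_filter, Finset.mem_Icc, Set.mem_ofPred_eq, Finset.coe_range,
        Set.mem_Iio] at ha ⊢
      omega
    · intro m hm hm'
      refine hlow m ?_
      by_contra hcon
      simp only [Finset.mem_range] at hm
      exact hm' ⟨n - m, by simp only [Finset.coe_filter, Finset.mem_Icc, Set.mem_ofPred_eq]; omega,
        by simp only; omega⟩
    · intro _ _
      rfl



theorem stmt4
    (V : Polynomial ℝ)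
    (hVeven : Even V.natDegree) (hVdeg : 2 ≤ V.natDegree)
    (hVlead : 0 < V.leadingCoeff)
    (hint : ∀ q : Polynomial ℝ,
      Integrable (fun x : ℝ => q.eval x * Real.exp (-(V.eval x))))
    (p : ℕ → Polynomial ℝ)
    (hmonic : ∀ n, (p n).Monic)
    (hpdeg : ∀ n, (p n).natDegree = n)
    (horth : ∀ n m, n ≠ m →
      ∫ x : ℝ, (p n).eval x * (p m).eval x * Real.exp (-(V.eval x)) = 0)
    (h : ℕ → ℝ)
    (hh : ∀ n, h n = ∫ x : ℝ, ((p n).eval x) ^ 2 * Real.exp (-(V.eval x)))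
    (hhpos : ∀ n, 0 < h n)
    (ψ : ℕ → ℝ → ℝ)
    (hψ : ∀ n x, ψ n x = (p n).eval x * Real.exp (-(V.eval x) / 2) / Real.sqrt (h n))
    (η : ℕ → ℕ → ℝ)
    (hη : ∀ k j, η k j = ∫ t : ℝ, (derivative V).eval t * ψ j t * ψ (j + k) t)
    (n : ℕ) (x : ℝ) :
    deriv (ψ n) x
      = -(1 / 2) * ∑ k ∈ Finset.Icc 1 (V.natDegree - 1),
          (η k n * ψ (n + k) x - if k ≤ n then η k (n - k) * ψ (n - k) x else 0) := by
  set d := V.natDegree - 1 with hd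
  set L := expWeightFunctional V hint with hL
  have hLapp : ∀ q, L q = ∫ x : ℝ, q.eval x * Real.exp (-(V.eval x)) := fun _ => rfl
  have horthL : ∀ n m, n ≠ m → L (p n * p m) = 0 := by
    intro n m hnm
    simpa only [hLapp, eval_mul] using horth n m hnm
  have hnorm : ∀ n, L (p n * p n) = h n := by
    intro n
    simp only [hLapp, hh, eval_mul, pow_two]
  have hdeg : ∀ n, (p n).degree = n := fun n => by
    rw [degree_eq_natDegree (hmonic n).ne_zero, hpdeg]
  have hlow := map_mul_eq_zero_of_degree_lt hmonic hpdeg L horthL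
  have hder : ∀ m, (derivative (p m)).degree < m := fun m => by
    simpa only [hdeg] using degree_derivative_lt (hmonic m).ne_zero
  have hV' : (derivative V).degree ≤ d := degree_le_natDegree.trans
    (by exact_mod_cast natDegree_derivative_le V)
  have hVp : ∀ m, (derivative V * p m).degree < (m + (d + 1) : ℕ) := fun m => by
    refine lt_of_le_of_lt (b := ((d + m : ℕ) : WithBot ℕ)) ?_ (by exact_mod_cast (by omega))
    rw [degree_mul, hdeg]
    push_cast
    gcongr
  have hpos : ∀ k, 0 < √(h k) := fun k => Real.sqrt_pos.2 (hhpos k)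
  have hdiv : ∀ (a : ℝ) (k : ℕ), a / h k = a / (√(h k) * √(h k)) := fun a k => by
    rw [Real.mul_self_sqrt (hhpos k).le]
  have hηL : ∀ k j, η k j = L (derivative V * p j * p (j + k)) / (√(h j) * √(h (j + k))) := by
    intro k j
    rw [hη, hLapp, ← integral_div]
    congr 1
    ext t
    have hexp : Real.exp (-(V.eval t))
        = Real.exp (-(V.eval t) / 2) * Real.exp (-(V.eval t) / 2) := by
      rw [← Real.exp_add, add_halves]
    rw [hψ, hψ, eval_mul, eval_mul, hexp]
    have := (hpos j).ne'
    have := (hpos (j + k)).ne'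
    generalize Real.exp (-(V.eval t) / 2) = E
    field_simp
  set q : ℝ[X] := derivative (p n) - (1 / 2 : ℝ) • (derivative V * p n) with hq
  have hqdeg : q.degree < (n + (d + 1) : ℕ) := by
    refine (degree_sub_le _ _).trans_lt (max_lt ((hder n).trans_le ?_)
      ((degree_smul_le _ _).trans_lt (hVp n)))
    exact_mod_cast (by omega)
  have hLq : ∀ m, L (q * p m)
      = L (derivative (p n) * p m) - 1 / 2 * L (derivative V * p n * p m) := by
    intro m
    rw [hq, sub_mul, smul_mul_assoc, map_sub, map_smul, smul_eq_mul]
  have hparts : ∀ m, L (derivative (p n) * p m) + L (derivative (p m) * p n)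
      = L (derivative V * p n * p m) := by
    intro m
    rw [mul_assoc, ← expWeightFunctional_derivative V hint, derivative_mul, map_add,
      mul_comm (p n)]
  have hup : ∀ m, n < m → L (q * p m) = -(1 / 2) * L (derivative V * p n * p m) := by
    intro m hm
    rw [hLq, hlow m _ ((hder n).trans (by exact_mod_cast hm))]
    ring
  have hself : L (q * p n) = 0 := by
    rw [hLq, ← hparts, hlow n _ (hder n)]
    ring
  have hdown : ∀ m, m < n → L (q * p m) = 1 / 2 * L (derivative V * p m * p n) := by
    intro m hm
    have h1 := hparts m
    rw [hlow n _ ((hder m).trans (by exact_mod_cast hm))] at h1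
    rw [hLq, mul_right_comm (derivative V) (p m)]
    linarith
  have hexp := eq_sum_div_smul_of_degree_lt hmonic hpdeg L horthL
    (fun k => by rw [hnorm]; exact (hhpos k).ne') _ q hqdeg
  simp only [hnorm] at hexp
  have hderiv : deriv (ψ n) x = q.eval x * Real.exp (-(V.eval x) / 2) / √(h n) := by
    have hfun : ψ n = fun x => (p n).eval x * Real.exp (-(V.eval x) / 2) / √(h n) :=
      funext (hψ n)
    rw [hfun]
    refine HasDerivAt.deriv ?_
    refine ((((p n).hasDerivAt x).mul
      ((V.hasDerivAt x).neg.div_const 2).exp).div_const (√(h n))).congr_deriv ?_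
    simp only [hq, eval_sub, eval_smul, eval_mul, smul_eq_mul, Pi.neg_apply]
    ring
  have hsum : deriv (ψ n) x = ∑ m ∈ Finset.range (n + (d + 1)),
      L (q * p m) / h m * (p m).eval x * Real.exp (-(V.eval x) / 2) / √(h n) := by
    rw [hderiv, ← Finset.sum_div, ← Finset.sum_mul]
    conv_lhs => rw [hexp]
    simp only [eval_finsetSum, eval_smul, smul_eq_mul]
  rw [hsum, sum_range_eq_sum_Icc_fold _ n d (by simp [hself]), Finset.mul_sum]
  · refine Finset.sum_congr rfl fun k hk => ?_
    have hk1 := (Finset.mem_Icc.1 hk).1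
    have hupper : L (q * p (n + k)) / h (n + k) * (p (n + k)).eval x
        * Real.exp (-(V.eval x) / 2) / √(h n) = -(1 / 2) * (η k n * ψ (n + k) x) := by
      rw [hup _ (by omega), hηL, hψ, hdiv]
      have := (hpos n).ne'
      have := (hpos (n + k)).ne'
      field_simp
    rw [hupper]
    split_ifs with hkn
    · obtain ⟨m, rfl⟩ := Nat.exists_eq_add_of_le' hkn
      rw [Nat.add_sub_cancel, hdown m (by omega), hηL k m, hψ m, hdiv]
      have := (hpos m).ne'
      have := (hpos (m + k)).ne'
      field_simp
      ring
    · ring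
  · intro m hm
    rw [hdown m (by omega), hlow n _ ((hVp m).trans_le (by exact_mod_cast (by omega)))]
    simp
end

section
/- For every u ∈ U, every k with 1 ≤ k ≤ D, and every n ∈ ℕ: the function u ↦ h_n(u) is differentiable in u_k and ∂(log h_n)/∂u_k = −(1/k) ∫_ℝ x^k ψ_n(u, x)² dx. (This is the diagonal deformation equation; note the sign is fixed by the convention ∂V_u/∂u_k = x^k/k.) -/
open MeasureTheory Polynomial Real

/-- A polynomial orthogonal to monic polynomials of every degree below `n` is orthogonal to all
polynomials of degree below `n`. -/
theorem integral_mul_eq_zero_of_degree_lt {w : ℝ → ℝ}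
    (hw : ∀ q : ℝ[X], Integrable (fun x => q.eval x * w x))
    {p : ℕ → ℝ[X]} (hmonic : ∀ n, (p n).Monic) (hdeg : ∀ n, (p n).natDegree = n)
    {r : ℝ[X]} {n : ℕ} (horth : ∀ m < n, ∫ x, (r * p m).eval x * w x = 0)
    {q : ℝ[X]} (hq : q.degree < n) :
    ∫ x, (r * q).eval x * w x = 0 := by
  suffices H : ∀ m ≤ n, ∀ q : ℝ[X], q.degree < m → ∫ x, (r * q).eval x * w x = 0 from
    H n le_rfl q hq
  intro m
  induction m with
  | zero =>
    intro _ q hq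
    have : q = 0 := by
      rw [← degree_eq_bot]
      exact Nat.WithBot.lt_zero_iff.mp (by simpa using hq)
    simp [this]
  | succ m ih =>
    intro hm q hq
    set s := q - C (q.coeff m) * p m with hs
    have hsdeg : s.degree < m := by
      rw [degree_lt_iff_coeff_zero]
      intro j hj
      rcases hj.eq_or_lt with rfl | hj
      · have h1 : (p m).coeff m = 1 := by
          have := hmonic m
          rwa [Monic, leadingCoeff, hdeg] at this
        simp [hs, h1]
      · have h1 : (p m).coeff j = 0 := coeff_eq_zero_of_natDegree_lt (by rwa [hdeg])
        have h2 : q.coeff j = 0 := (degree_lt_iff_coeff_zero _ _).mp hq j hj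
        simp [hs, h1, h2]
    have hsplit : ∀ x, (r * q).eval x * w x =
        (r * s).eval x * w x + q.coeff m * ((r * p m).eval x * w x) := by
      intro x
      simp only [hs, eval_mul, eval_sub, eval_C]
      ring
    simp_rw [hsplit]
    rw [integral_add (hw _) ((hw _).const_mul _), integral_const_mul,
      ih (by omega) s hsdeg, horth m (by omega)]
    simp

/-- Integration of a polynomial against a weight, expanded in moments. -/
theorem integral_eval_mul_eq_sum {w : ℝ → ℝ}
    (hw : ∀ q : ℝ[X], Integrable (fun x => q.eval x * w x))
    {q : ℝ[X]} {N : ℕ} (hq : q.natDegree < N) :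
    ∫ x, q.eval x * w x = ∑ m ∈ Finset.range N, q.coeff m * ∫ x, x ^ m * w x := by
  have hmom : ∀ m : ℕ, Integrable (fun x => x ^ m * w x) := fun m => by simpa using hw (X ^ m)
  simp_rw [eval_eq_sum_range' hq, Finset.sum_mul, mul_assoc]
  rw [integral_finsetSum _ fun m _ => (hmom m).const_mul _]
  simp_rw [integral_const_mul]

/-- Differentiation under the integral sign for an exponential family of weights all of whose
moments exist. -/
theorem hasDerivAt_integral_mul_exp {w f g : ℝ → ℝ} {ε : ℝ} (hε : 0 < ε)
    (hf : ∀ s, |s| ≤ ε → Integrable (fun x => f x * (w x * exp (-(s * g x)))))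
    (hfg : ∀ s, |s| ≤ ε → Integrable (fun x => g x * f x * (w x * exp (-(s * g x))))) :
    HasDerivAt (fun s => ∫ x, f x * (w x * exp (-(s * g x))))
      (-∫ x, g x * f x * w x) 0 := by
  have h0' : Integrable (fun x => g x * f x * w x) := by simpa using hfg 0 (by simpa using hε.le)
  have key := hasDerivAt_integral_of_dominated_loc_of_deriv_le
    (μ := volume) (𝕜 := ℝ) (x₀ := (0 : ℝ)) (s := Metric.ball 0 ε)
    (F := fun s x => f x * (w x * exp (-(s * g x))))
    (F' := fun s x => -(g x * f x * (w x * exp (-(s * g x)))))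
    (bound := fun x => ‖g x * f x * (w x * exp (-(ε * g x)))‖ +
      ‖g x * f x * (w x * exp (-(-ε * g x)))‖)
    (Metric.ball_mem_nhds 0 hε)
    (by
      filter_upwards [Metric.ball_mem_nhds 0 hε] with s hs
      exact (hf s (by simpa using (Metric.mem_ball.mp hs).le)).aestronglyMeasurable)
    (hf 0 (by simpa using hε.le))
    (by simpa [Pi.neg_def] using h0'.aestronglyMeasurable.neg)
    (by
      refine Filter.Eventually.of_forall fun x s hs => ?_
      have hs : |s| < ε := by simpa using hs
      have hexp : exp (-(s * g x)) ≤ exp (-(ε * g x)) + exp (-(-ε * g x)) := by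
        obtain ⟨h1, h2⟩ := abs_lt.mp hs
        rcases le_total 0 (g x) with hx | hx
        · have : exp (-(s * g x)) ≤ exp (-(-ε * g x)) := exp_le_exp.mpr (by nlinarith)
          linarith [exp_pos (-(ε * g x))]
        · have : exp (-(s * g x)) ≤ exp (-(ε * g x)) := exp_le_exp.mpr (by nlinarith)
          linarith [exp_pos (-(-ε * g x))]
      simp only [norm_neg, norm_mul, Real.norm_eq_abs, abs_exp]
      rw [← mul_add, ← mul_add]
      gcongr)
    ((hfg ε (abs_of_pos hε).le).norm.add (hfg (-ε) (by simp [abs_of_pos hε])).norm)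
    (by
      refine Filter.Eventually.of_forall fun x s _ => ?_
      have h1 : HasDerivAt (fun s : ℝ => -(s * g x)) (-(1 * g x)) s :=
        ((hasDerivAt_id s).mul_const (g x)).neg
      exact ((h1.exp.const_mul (w x)).const_mul (f x)).congr_deriv (by ring))
  exact key.2.congr_deriv (by simp [integral_neg])

/-- Product rule for the coefficients of the square of a differentiable family of polynomials. -/
theorem hasDerivAt_coeff_sq {P : ℝ → ℝ[X]} {Q : ℝ[X]} {t : ℝ}
    (hP : ∀ j, HasDerivAt (fun s => (P s).coeff j) (Q.coeff j) t) (m : ℕ) :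
    HasDerivAt (fun s => (P s ^ 2).coeff m) ((2 * (P t * Q)).coeff m) t := by
  have h2 : 2 * (P t * Q) = Q * P t + P t * Q := by ring
  rw [h2]
  simp only [sq, coeff_mul, coeff_add, ← Finset.sum_add_distrib]
  exact HasDerivAt.fun_sum fun x _ => (hP x.1).mul (hP x.2)


theorem stmt13
    (D : ℕ) (hDeven : Even D) (hD2 : 2 ≤ D)
    (U : Set (Fin D → ℝ)) (hUopen : IsOpen U)
    (hUpos : ∀ u ∈ U, 0 < u ⟨D - 1, by omega⟩)
    (Vf : (Fin D → ℝ) → ℝ → ℝ)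
    (hVf : ∀ (u : Fin D → ℝ) (x : ℝ),
      Vf u x = ∑ i : Fin D, u i / ((i : ℕ) + 1) * x ^ ((i : ℕ) + 1))
    (hint : ∀ u ∈ U, ∀ q : Polynomial ℝ,
      Integrable (fun x : ℝ => q.eval x * Real.exp (-(Vf u x))))
    (p : (Fin D → ℝ) → ℕ → Polynomial ℝ)
    (hmonic : ∀ u ∈ U, ∀ n, (p u n).Monic)
    (hpdeg : ∀ u ∈ U, ∀ n, (p u n).natDegree = n)
    (horth : ∀ u ∈ U, ∀ n m, n ≠ m →
      ∫ x : ℝ, (p u n).eval x * (p u m).eval x * Real.exp (-(Vf u x)) = 0)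
    (h : (Fin D → ℝ) → ℕ → ℝ)
    (hh : ∀ (u : Fin D → ℝ) (n : ℕ),
      h u n = ∫ x : ℝ, ((p u n).eval x) ^ 2 * Real.exp (-(Vf u x)))
    (hhpos : ∀ u ∈ U, ∀ n, 0 < h u n)
    (ψ : (Fin D → ℝ) → ℕ → ℝ → ℝ)
    (hψ : ∀ (u : Fin D → ℝ) (n : ℕ) (x : ℝ),
      ψ u n x = (p u n).eval x * Real.exp (-(Vf u x) / 2) / Real.sqrt (h u n))
    (hcoeff : ∀ n j, DifferentiableOn ℝ (fun u => (p u n).coeff j) U)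
    (u : Fin D → ℝ) (hu : u ∈ U) (i : Fin D) (n : ℕ) :
    DifferentiableAt ℝ (fun t => h (Function.update u i t) n) (u i) ∧
    HasDerivAt (fun t => Real.log (h (Function.update u i t) n))
      (-(1 / ((i : ℕ) + 1 : ℝ)) * ∫ x : ℝ, x ^ ((i : ℕ) + 1) * (ψ u n x) ^ 2)
      (u i) := by
  set k : ℕ := (i : ℕ) + 1 with hk
  set w : ℝ → ℝ → ℝ := fun t x => exp (-(Vf (Function.update u i t) x)) with hw
  have hcont : Continuous (fun t : ℝ => Function.update u i t) :=
    continuous_const.update i continuous_id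
  have hnhds : ∀ᶠ t in nhds (u i), Function.update u i t ∈ U :=
    hcont.continuousAt.eventually_mem (by simpa using hUopen.mem_nhds hu)
  obtain ⟨ε, hε, hball⟩ := Metric.nhds_basis_closedBall.mem_iff.mp hnhds
  have hV : ∀ t x, Vf (Function.update u i t) x = Vf u x + (t - u i) * (x ^ k / k) := by
    intro t x
    have hdiff : ∑ j : Fin D, (Function.update u i t j - u j) / ((j : ℕ) + 1) * x ^ ((j : ℕ) + 1)
        = (t - u i) * (x ^ k / k) := by
      rw [Finset.sum_eq_single i]
      · simp only [Function.update_self, hk]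
        push_cast
        ring
      · intro j _ hj
        simp [Function.update_of_ne hj]
      · simp
    rw [hVf, hVf, ← hdiff, ← Finset.sum_add_distrib]
    exact Finset.sum_congr rfl fun j _ => by ring
  have hwexp : ∀ s x, w (u i + s) x = exp (-(Vf u x)) * exp (-(s * (x ^ k / k))) := by
    intro s x
    simp only [hw, hV, ← exp_add]
    congr 1
    ring
  have hwint : ∀ t, Function.update u i t ∈ U → ∀ q : ℝ[X],
      Integrable (fun x => q.eval x * w t x) := fun t ht q => hint _ ht q
  have hmoment : ∀ m : ℕ, HasDerivAt (fun t => ∫ x, x ^ m * w t x)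
      (-∫ x, x ^ k / k * x ^ m * exp (-(Vf u x))) (u i) := by
    intro m
    have hmem : ∀ s, |s| ≤ ε → Function.update u i (u i + s) ∈ U := fun s hs =>
      hball (by simpa using hs)
    have hd := hasDerivAt_integral_mul_exp (w := fun x => exp (-(Vf u x))) (f := fun x => x ^ m)
      (g := fun x => x ^ k / (k : ℝ)) hε
      (fun s hs => by simpa [hwexp] using hwint _ (hmem s hs) (X ^ m))
      (fun s hs => by
        convert hwint _ (hmem s hs) (C (1 / (k : ℝ)) * X ^ k * X ^ m) using 2 with x
        rw [hwexp]
        simp only [eval_mul, eval_C, eval_pow, eval_X]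
        ring)
    simp_rw [← hwexp] at hd
    have hd' := HasDerivAt.comp_sub_const (u i) (u i) (by simpa using hd)
    simpa using hd'
  set P : ℝ → ℝ[X] := fun t => p (Function.update u i t) n with hPdef
  have hPu : P (u i) = p u n := by simp [hPdef]
  set Q : ℝ[X] := ∑ j ∈ Finset.range n,
    C (deriv (fun t => (P t).coeff j) (u i)) * X ^ j with hQdef
  have hP : ∀ j, HasDerivAt (fun t => (P t).coeff j) (Q.coeff j) (u i) := by
    intro j
    have hQj : Q.coeff j = if j < n then deriv (fun t => (P t).coeff j) (u i) else 0 := by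
      simp [hQdef, coeff_C_mul, coeff_X_pow]
    rw [hQj]
    split_ifs with hj
    · have h1 : DifferentiableAt ℝ (fun u => (p u n).coeff j) (Function.update u i (u i)) := by
        rw [Function.update_eq_self]
        exact (hcoeff n j).differentiableAt (hUopen.mem_nhds hu)
      exact (h1.comp (u i) (hasDerivAt_update u i (u i)).differentiableAt).hasDerivAt
    · refine (hasDerivAt_const (u i) (if j = n then (1 : ℝ) else 0)).congr_of_eventuallyEq ?_
      filter_upwards [hnhds] with t ht
      split_ifs with hjn
      · have := hmonic _ ht n
        rw [Monic, leadingCoeff, hpdeg _ ht] at this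
        rw [hjn]
        exact this
      · exact coeff_eq_zero_of_natDegree_lt (by rw [hpdeg _ ht]; omega)
  have hQdeg : Q.degree < n := by
    rw [degree_lt_iff_coeff_zero]
    intro j hj
    simp [hQdef, coeff_C_mul, coeff_X_pow, hj]
  have hexpand : ∀ t, Function.update u i t ∈ U → h (Function.update u i t) n =
      ∑ m ∈ Finset.range (2 * n + 1), (P t ^ 2).coeff m * ∫ x, x ^ m * w t x := by
    intro t ht
    have hdeg : (P t ^ 2).natDegree < 2 * n + 1 := by
      rw [natDegree_pow, hpdeg _ ht]
      omega
    rw [hh, ← integral_eval_mul_eq_sum (hwint t ht) hdeg]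
    simp [hPdef, hw]
  have hwu : w (u i) = fun x => exp (-(Vf u x)) := by simp [hw]
  have hwu_int := hint u hu
  have hsum : HasDerivAt (fun t => h (Function.update u i t) n)
      (-∫ x, x ^ k / k * (p u n).eval x ^ 2 * exp (-(Vf u x))) (u i) := by
    have hd := HasDerivAt.fun_sum (u := Finset.range (2 * n + 1)) fun m _ =>
      (hasDerivAt_coeff_sq hP m).mul (hmoment m)
    refine (hd.congr_of_eventuallyEq (hnhds.mono hexpand)).congr_deriv ?_
    rw [Finset.sum_add_distrib, hPu, hwu]
    have hQnat : (2 * (p u n * Q)).natDegree < 2 * n + 1 := by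
      have h1 : Q.natDegree ≤ n := natDegree_le_of_degree_le hQdeg.le
      have h2 : (2 * (p u n * Q)).natDegree ≤ (2 : ℝ[X]).natDegree + (p u n * Q).natDegree :=
        natDegree_mul_le
      have h3 : (p u n * Q).natDegree ≤ (p u n).natDegree + Q.natDegree := natDegree_mul_le
      have h4 : (2 : ℝ[X]).natDegree = 0 := natDegree_ofNat 2
      have h5 := hpdeg u hu n
      omega
    have hzero : ∑ m ∈ Finset.range (2 * n + 1), (2 * (p u n * Q)).coeff m *
        ∫ x, x ^ m * exp (-(Vf u x)) = 0 := by
      rw [← integral_eval_mul_eq_sum hwu_int hQnat]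
      have := integral_mul_eq_zero_of_degree_lt hwu_int (hmonic u hu) (hpdeg u hu) (r := p u n)
        (fun m hm => by simpa using horth u hu n m hm.ne') hQdeg
      have h2 : ∀ x, (2 * (p u n * Q)).eval x * exp (-(Vf u x)) =
          2 * ((p u n * Q).eval x * exp (-(Vf u x))) := fun x => by
        rw [eval_mul, eval_ofNat, mul_assoc]
      simp_rw [h2]
      rw [integral_const_mul, this, mul_zero]
    have hsq : (p u n ^ 2).natDegree < 2 * n + 1 := by
      rw [natDegree_pow, hpdeg u hu]
      omega
    have hwk : ∀ q : ℝ[X], Integrable (fun x => q.eval x * (x ^ k / k * exp (-(Vf u x)))) := by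
      intro q
      convert hwu_int (q * (C (1 / (k : ℝ)) * X ^ k)) using 2 with x
      simp only [eval_mul, eval_C, eval_pow, eval_X]
      ring
    have hlast := integral_eval_mul_eq_sum hwk hsq
    rw [hzero, zero_add]
    simp_rw [mul_neg, Finset.sum_neg_distrib]
    congr 1
    have hcomm : ∀ a x : ℝ, x ^ k / k * a * exp (-(Vf u x)) = a * (x ^ k / k * exp (-(Vf u x))) :=
      fun a x => by ring
    simp_rw [hcomm]
    simpa only [eval_pow] using hlast.symm
  refine ⟨hsum.differentiableAt, ?_⟩
  have hpos := hhpos u hu n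
  refine (hsum.log (by simpa using hpos.ne')).congr_deriv ?_
  have hψsq : ∀ x, x ^ k * ψ u n x ^ 2 =
      k / h u n * (x ^ k / k * (p u n).eval x ^ 2 * exp (-(Vf u x))) := by
    intro x
    have he : exp (-(Vf u x) / 2) ^ 2 = exp (-(Vf u x)) := by
      rw [← exp_nat_mul]
      congr 1
      push_cast
      ring
    have hk0 : (k : ℝ) ≠ 0 := by positivity
    rw [hψ, div_pow, mul_pow, he, sq_sqrt hpos.le]
    field_simp
  simp_rw [hψsq]
  rw [integral_const_mul, Function.update_eq_self]
  have hk1 : ((i : ℕ) + 1 : ℝ) = k := by simp [hk]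
  have hk0 : (k : ℝ) ≠ 0 := by positivity
  rw [hk1]
  field_simp
end

section
/- (Explicit deformation system.) For every u ∈ U, every k with 1 ≤ k ≤ D, every n ≥ 1 and every x ∈ ℝ: ∂ψ_{n−1}/∂u_k (u, x) = [ (x^k − M^k_{n−1,n−1}(u))/(2k) + (γ_n(u)/k) T^k_{n,n−1}(u, x) ] ψ_{n−1}(u, x) − (γ_n(u)/k) T^k_{n−1,n−1}(u, x) ψ_n(u, x), and ∂ψ_n/∂u_k (u, x) = (γ_n(u)/k) T^k_{n,n}(u, x) ψ_{n−1}(u, x) + [ (M^k_{n,n}(u) − x^k)/(2k) − (γ_n(u)/k) T^k_{n,n−1}(u, x) ] ψ_n(u, x). -/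
open MeasureTheory Polynomial Real

section OrthogonalPolynomials

variable {F : Type*} [Field F]

theorem Polynomial.degree_C_mul_le (a : F) (q : F[X]) : (C a * q).degree ≤ q.degree := by
  rw [← smul_eq_C_mul]
  exact degree_smul_le a q

theorem LinearMap.map_C_mul_polynomial (L : F[X] →ₗ[F] F) (a : F) (q : F[X]) :
    L (C a * q) = a * L q := by
  rw [← smul_eq_C_mul, map_smul, smul_eq_mul]

/-- A monic sequence `P` with `deg P n = n` that is orthogonal, with nonzero square norms, for the
functional `L`. -/
structure IsMonicOrthogonal (L : F[X] →ₗ[F] F) (P : ℕ → F[X]) : Prop where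
  monic : ∀ n, (P n).Monic
  natDegree_eq : ∀ n, (P n).natDegree = n
  orthogonal : ∀ n m, n ≠ m → L (P n * P m) = 0
  norm_ne_zero : ∀ n, L (P n * P n) ≠ 0

/-- The reproducing kernel of the polynomials of degree less than `n`, as a polynomial in its second
variable. -/
noncomputable def reproducingKernel (L : F[X] →ₗ[F] F) (P : ℕ → F[X]) (n : ℕ) (x : F) : F[X] :=
  ∑ l ∈ Finset.range n, C ((P l).eval x / L (P l * P l)) * P l

theorem map_mul_reproducingKernel (L : F[X] →ₗ[F] F) (P : ℕ → F[X]) (n : ℕ) (x : F)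
    (q : F[X]) :
    L (q * reproducingKernel L P n x) =
      ∑ l ∈ Finset.range n, (P l).eval x / L (P l * P l) * L (q * P l) := by
  rw [reproducingKernel, Finset.mul_sum, map_sum]
  refine Finset.sum_congr rfl fun l _ => ?_
  rw [mul_left_comm, L.map_C_mul_polynomial]

theorem map_mul_reproducingKernel_succ (L : F[X] →ₗ[F] F) (P : ℕ → F[X]) (n : ℕ) (x : F)
    (q : F[X]) :
    L (q * reproducingKernel L P (n + 1) x) =
      L (q * reproducingKernel L P n x) + (P n).eval x / L (P n * P n) * L (q * P n) := by
  simp only [map_mul_reproducingKernel, Finset.sum_range_succ]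

namespace IsMonicOrthogonal

variable {L : F[X] →ₗ[F] F} {P : ℕ → F[X]}

theorem degree_eq (hP : IsMonicOrthogonal L P) (n : ℕ) : (P n).degree = n := by
  rw [degree_eq_natDegree (hP.monic n).ne_zero, hP.natDegree_eq]

theorem exists_eq_sum (hP : IsMonicOrthogonal L P) (n : ℕ) (q : F[X]) (hq : q.degree < n) :
    ∃ c : ℕ → F, q = ∑ l ∈ Finset.range n, C (c l) * P l := by
  induction n generalizing q with
  | zero =>
    refine ⟨0, ?_⟩
    simpa [Nat.WithBot.lt_zero_iff] using hq
  | succ n ih =>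
    have hlow : (q - C (q.coeff n) * P n).degree < n := by
      rw [degree_lt_iff_coeff_zero]
      intro j hj
      rw [coeff_sub, coeff_C_mul]
      rcases hj.eq_or_lt with rfl | hj
      · have := (hP.monic n).coeff_natDegree
        rw [hP.natDegree_eq] at this
        rw [this, mul_one, sub_self]
      · rw [(degree_lt_iff_coeff_zero q (n + 1)).1 hq j hj,
          (P n).coeff_eq_zero_of_natDegree_lt (by rwa [hP.natDegree_eq]), mul_zero, sub_zero]
    obtain ⟨c, hc⟩ := ih _ hlow
    refine ⟨Function.update c n (q.coeff n), ?_⟩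
    rw [Finset.sum_range_succ, Function.update_self, ← sub_eq_iff_eq_add, hc]
    refine Finset.sum_congr rfl fun l hl => ?_
    rw [Function.update_of_ne (Finset.mem_range.1 hl).ne]

theorem map_sum_mul (hP : IsMonicOrthogonal L P) (n : ℕ) (c : ℕ → F) (m : ℕ) :
    L ((∑ l ∈ Finset.range n, C (c l) * P l) * P m) =
      if m < n then c m * L (P m * P m) else 0 := by
  have : ∀ l, L (C (c l) * P l * P m) = if l = m then c m * L (P m * P m) else 0 := by
    intro l
    rw [mul_assoc, L.map_C_mul_polynomial]
    split_ifs with h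
    · rw [h]
    · rw [hP.orthogonal _ _ h, mul_zero]
  simp [Finset.sum_mul, map_sum, this]

theorem map_mul_eq_zero (hP : IsMonicOrthogonal L P) {n : ℕ} {q : F[X]} (hq : q.degree < n) :
    L (q * P n) = 0 := by
  obtain ⟨c, rfl⟩ := hP.exists_eq_sum n q hq
  simp [hP.map_sum_mul]

theorem eq_sum (hP : IsMonicOrthogonal L P) {n : ℕ} {q : F[X]} (hq : q.degree < n) :
    q = ∑ l ∈ Finset.range n, C (L (q * P l) / L (P l * P l)) * P l := by
  obtain ⟨c, rfl⟩ := hP.exists_eq_sum n q hq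
  refine Finset.sum_congr rfl fun l hl => ?_
  rw [hP.map_sum_mul, if_pos (Finset.mem_range.1 hl), mul_div_cancel_right₀ _ (hP.norm_ne_zero l)]

theorem map_mul_reproducingKernel_eq_eval (hP : IsMonicOrthogonal L P) {n : ℕ} {q : F[X]}
    (hq : q.degree < n) (x : F) : L (q * reproducingKernel L P n x) = q.eval x := by
  conv_rhs => rw [hP.eq_sum hq]
  rw [map_mul_reproducingKernel, eval_finsetSum]
  refine Finset.sum_congr rfl fun l _ => ?_
  rw [eval_mul, eval_C]
  ring

theorem map_mul_reproducingKernel_self (hP : IsMonicOrthogonal L P) (n : ℕ) (x : F) :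
    L (P n * reproducingKernel L P n x) = 0 := by
  rw [map_mul_reproducingKernel]
  refine Finset.sum_eq_zero fun l hl => ?_
  rw [hP.orthogonal _ _ (Finset.mem_range.1 hl).ne', mul_zero]

theorem degree_sub_X_mul_add_lt (hP : IsMonicOrthogonal L P) (m : ℕ) (x : F) :
    ((C x - X) * P m + P (m + 1)).degree < ((m + 1 : ℕ) : WithBot ℕ) := by
  have hX : (X * P m).Monic := monic_X.mul (hP.monic m)
  have hXdeg : (X * P m).degree = ((m + 1 : ℕ) : WithBot ℕ) := by
    rw [degree_mul, degree_X, hP.degree_eq]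
    push_cast
    exact add_comm _ _
  have h1 : (P (m + 1) - X * P m).degree < ((m + 1 : ℕ) : WithBot ℕ) := by
    rw [← hP.degree_eq (m + 1)]
    refine degree_sub_lt_left ?_ (hP.monic _).ne_zero ?_
    · rw [hXdeg, hP.degree_eq]
    · rw [(hP.monic _).leadingCoeff, hX.leadingCoeff]
  have h2 : (C x * P m).degree < ((m + 1 : ℕ) : WithBot ℕ) := by
    refine (degree_C_mul_le _ _).trans_lt ?_
    rw [hP.degree_eq]
    exact_mod_cast m.lt_succ_self
  have : (C x - X) * P m + P (m + 1) = C x * P m + (P (m + 1) - X * P m) := by ring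
  rw [this]
  exact (degree_add_le _ _).trans_lt (max_lt h2 h1)

theorem degree_sub_X_mul_lt {m n : ℕ} {q : F[X]} (hq : q.degree ≤ m) (hmn : m + 1 < n) (x : F) :
    ((C x - X) * q).degree < (n : WithBot ℕ) := by
  have h1 : (C x - X : F[X]).degree ≤ 1 := by
    refine (degree_sub_le _ _).trans (max_le (degree_C_le.trans zero_le_one) degree_X_le)
  refine (degree_mul_le _ _).trans_lt ((add_le_add h1 hq).trans_lt ?_)
  rw [add_comm]
  exact_mod_cast hmn

/-- The **Christoffel–Darboux formula**. -/
theorem sub_X_mul_reproducingKernel (hP : IsMonicOrthogonal L P) (m : ℕ) (x : F) :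
    (C x - X) * reproducingKernel L P (m + 1) x =
      C (1 / L (P m * P m)) * (C ((P (m + 1)).eval x) * P m - C ((P m).eval x) * P (m + 1)) := by
  set K := reproducingKernel L P (m + 1) x with hK
  have hKdeg : K.degree ≤ m := by
    rw [hK, reproducingKernel]
    refine (degree_sum_le _ _).trans (Finset.sup_le fun l hl => ?_)
    refine (degree_C_mul_le _ _).trans ?_
    rw [hP.degree_eq]
    exact_mod_cast Nat.lt_succ_iff.1 (Finset.mem_range.1 hl)
  have hlow : ∀ l < m, L ((C x - X) * K * P l) = 0 := by
    intro l hl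
    have hd := degree_sub_X_mul_lt (hP.degree_eq l).le (Nat.succ_lt_succ hl) x
    rw [mul_right_comm, hP.map_mul_reproducingKernel_eq_eval hd]
    simp
  have hm : L ((C x - X) * K * P m) = (P (m + 1)).eval x := by
    have : (C x - X) * K * P m = ((C x - X) * P m + P (m + 1)) * K - P (m + 1) * K := by ring
    rw [this, map_sub, hP.map_mul_reproducingKernel_eq_eval (hP.degree_sub_X_mul_add_lt m x),
      hP.map_mul_reproducingKernel_self]
    simp
  have hm1 : L ((C x - X) * K * P (m + 1)) =
      -((P m).eval x / L (P m * P m) * L (P (m + 1) * P (m + 1))) := by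
    have h0 : ∀ l < m, L ((C x - X) * P (m + 1) * P l) = 0 := by
      intro l hl
      rw [mul_right_comm]
      exact hP.map_mul_eq_zero
        (degree_sub_X_mul_lt (hP.degree_eq l).le (Nat.succ_lt_succ hl) x)
    have h1 : L ((C x - X) * P (m + 1) * P m) = -L (P (m + 1) * P (m + 1)) := by
      have : (C x - X) * P (m + 1) * P m =
          ((C x - X) * P m + P (m + 1)) * P (m + 1) - P (m + 1) * P (m + 1) := by ring
      rw [this, map_sub, hP.map_mul_eq_zero (hP.degree_sub_X_mul_add_lt m x), zero_sub]
    rw [mul_right_comm, map_mul_reproducingKernel, Finset.sum_range_succ,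
      Finset.sum_eq_zero fun l hl => by rw [h0 l (Finset.mem_range.1 hl), mul_zero], h1]
    ring
  rw [hP.eq_sum (degree_sub_X_mul_lt hKdeg (m + 1).lt_succ_self x), Finset.sum_range_succ,
    Finset.sum_range_succ, Finset.sum_eq_zero fun l hl => by
      rw [hlow l (Finset.mem_range.1 hl), zero_div, C_0, zero_mul], hm, hm1, neg_div,
    mul_div_cancel_right₀ _ (hP.norm_ne_zero (m + 1)), C_neg, div_eq_mul_one_div, C_mul,
    div_eq_mul_one_div ((P m).eval x), C_mul]
  ring

theorem map_X_pow_mul_reproducingKernel (hP : IsMonicOrthogonal L P) (m k : ℕ) (x : F)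
    (f : F[X]) :
    L (X ^ k * f * reproducingKernel L P (m + 1) x) =
      x ^ k * L (f * reproducingKernel L P (m + 1) x) -
        1 / L (P m * P m) *
          ((P (m + 1)).eval x *
              L ((∑ j ∈ Finset.range k, C x ^ j * X ^ (k - 1 - j)) * (f * P m)) -
            (P m).eval x *
              L ((∑ j ∈ Finset.range k, C x ^ j * X ^ (k - 1 - j)) * (f * P (m + 1)))) := by
  have hgeom := geom_sum₂_mul (C x) (X : F[X]) k
  set S : F[X] := ∑ j ∈ Finset.range k, C x ^ j * X ^ (k - 1 - j)
  set K := reproducingKernel L P (m + 1) x with hK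
  have h : X ^ k * f * K = C (x ^ k) * (f * K) - C (1 / L (P m * P m)) *
      (C ((P (m + 1)).eval x) * (S * (f * P m)) -
        C ((P m).eval x) * (S * (f * P (m + 1)))) := by
    have hCD := hP.sub_X_mul_reproducingKernel m x
    rw [← hK] at hCD
    rw [C_pow]
    linear_combination (f * K) * hgeom - (S * f) * hCD
  rw [h]
  simp only [map_sub, L.map_C_mul_polynomial]

end IsMonicOrthogonal

end OrthogonalPolynomials

section ExponentialWeight

open Filter Topology

/-- Integration of polynomials against a weight with finite moments. -/
noncomputable def weightFunctional (w : ℝ → ℝ)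
    (hw : ∀ q : ℝ[X], Integrable fun x => q.eval x * w x) : ℝ[X] →ₗ[ℝ] ℝ where
  toFun q := ∫ x, q.eval x * w x
  map_add' p q := by
    simp only [eval_add, add_mul]
    exact integral_add (hw p) (hw q)
  map_smul' c q := by
    simp only [eval_smul, smul_eq_mul, mul_assoc, RingHom.id_apply]
    exact integral_const_mul _ _

/-- Differentiation under the integral sign for the weight `exp (-(A + t b))`. -/
theorem hasDerivAt_integral_eval_mul_exp {A : ℝ → ℝ} (b : ℝ[X]) {s : ℝ}
    (hint : ∀ᶠ t in 𝓝 s, ∀ q : ℝ[X],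
      Integrable fun x => q.eval x * exp (-(A x + t * b.eval x)))
    (q : ℝ[X]) :
    HasDerivAt (fun t => ∫ x, q.eval x * exp (-(A x + t * b.eval x)))
      (-∫ x, (b * q).eval x * exp (-(A x + s * b.eval x))) s := by
  obtain ⟨ε, hε, hball⟩ := Metric.eventually_nhds_iff.1 hint
  have hI : ∀ t, |t - s| < ε → ∀ q : ℝ[X],
      Integrable fun x => q.eval x * exp (-(A x + t * b.eval x)) :=
    fun t ht => hball (by rwa [Real.dist_eq])
  have hs := hI s (by simpa using hε)
  have hp := hI (s + ε / 2) (by rw [add_sub_cancel_left, abs_of_pos] <;> linarith) (b * q)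
  have hm := hI (s - ε / 2) (by rw [sub_sub_cancel_left, abs_neg, abs_of_pos] <;> linarith) (b * q)
  have key := hasDerivAt_integral_of_dominated_loc_of_deriv_le (μ := volume)
    (F := fun t x => q.eval x * exp (-(A x + t * b.eval x)))
    (F' := fun t x => -((b * q).eval x * exp (-(A x + t * b.eval x))))
    (x₀ := s) (s := Metric.ball s (ε / 2))
    (bound := fun x => ‖(b * q).eval x * exp (-(A x + (s + ε / 2) * b.eval x))‖ +
      ‖(b * q).eval x * exp (-(A x + (s - ε / 2) * b.eval x))‖)
    (Metric.ball_mem_nhds s (by positivity))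
    (hint.mono fun t ht => (ht q).aestronglyMeasurable) (hs q)
    (hs (b * q)).neg.aestronglyMeasurable ?_ (hp.norm.add hm.norm) ?_
  · simpa only [integral_neg] using key.2
  · refine Eventually.of_forall fun x t ht => ?_
    rw [Metric.mem_ball, Real.dist_eq, abs_lt] at ht
    simp only [norm_neg, norm_mul, Real.norm_eq_abs, abs_exp]
    rw [← mul_add]
    refine mul_le_mul_of_nonneg_left ?_ (abs_nonneg _)
    rcases le_total 0 (b.eval x) with hb | hb
    · refine le_add_of_nonneg_of_le (exp_pos _).le (exp_le_exp.2 ?_)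
      nlinarith
    · refine le_add_of_le_of_nonneg (exp_le_exp.2 ?_) (exp_pos _).le
      nlinarith
  · refine Eventually.of_forall fun x t _ => ?_
    have := (((hasDerivAt_id t).mul_const (b.eval x)).const_add (A x)).neg.exp.const_mul (q.eval x)
    refine this.congr_deriv ?_
    simp only [id, eval_mul, Pi.neg_apply]
    ring

/-- A family of real polynomials of locally bounded degree with coefficientwise derivative `f'`
at `s`. -/
structure HasPolynomialDerivAt (f : ℝ → ℝ[X]) (f' : ℝ[X]) (s : ℝ) : Prop where
  coeff : ∀ j, HasDerivAt (fun t => (f t).coeff j) (f'.coeff j) s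
  bounded : ∃ N, ∀ᶠ t in 𝓝 s, (f t).natDegree < N

namespace HasPolynomialDerivAt

variable {f g : ℝ → ℝ[X]} {f' g' : ℝ[X]} {s : ℝ}

theorem exists_sum (hf : HasPolynomialDerivAt f f' s) :
    ∃ N, (∀ᶠ t in 𝓝 s, f t = ∑ j ∈ Finset.range N, C ((f t).coeff j) * X ^ j) ∧
      f' = ∑ j ∈ Finset.range N, C (f'.coeff j) * X ^ j := by
  obtain ⟨N, hN⟩ := hf.bounded
  refine ⟨N + 1, hN.mono fun t ht => ?_, ?_⟩
  · exact as_sum_range_C_mul_X_pow' _ (by omega)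
  · refine as_sum_range_C_mul_X_pow' _ (Nat.lt_succ_iff.2 (natDegree_le_iff_coeff_eq_zero.2 ?_))
    intro j hj
    refine (hf.coeff j).unique ((hasDerivAt_const s (0 : ℝ)).congr_of_eventuallyEq ?_)
    exact hN.mono fun t ht => coeff_eq_zero_of_natDegree_lt (ht.trans hj)

theorem mul (hf : HasPolynomialDerivAt f f' s) (hg : HasPolynomialDerivAt g g' s) :
    HasPolynomialDerivAt (fun t => f t * g t) (f' * g s + f s * g') s where
  coeff j := by
    simp only [coeff_add, coeff_mul, ← Finset.sum_add_distrib]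
    exact HasDerivAt.fun_sum fun a _ => (hf.coeff a.1).mul (hg.coeff a.2)
  bounded := by
    obtain ⟨N, hN⟩ := hf.bounded
    obtain ⟨N', hN'⟩ := hg.bounded
    refine ⟨N + N', ?_⟩
    filter_upwards [hN, hN'] with t ht ht'
    exact natDegree_mul_le.trans_lt (add_lt_add ht ht')

theorem eval (hf : HasPolynomialDerivAt f f' s) (x : ℝ) :
    HasDerivAt (fun t => (f t).eval x) (f'.eval x) s := by
  obtain ⟨N, hN, hN'⟩ := hf.exists_sum
  have : HasDerivAt (fun t => ∑ j ∈ Finset.range N, (f t).coeff j * x ^ j)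
      (∑ j ∈ Finset.range N, f'.coeff j * x ^ j) s :=
    HasDerivAt.fun_sum fun j _ => (hf.coeff j).mul_const _
  rw [hN']
  simp only [eval_finsetSum, eval_mul, eval_C, eval_pow, eval_X]
  refine this.congr_of_eventuallyEq (hN.mono fun t ht => ?_)
  dsimp only
  conv_lhs => rw [ht]
  simp only [eval_finsetSum, eval_mul, eval_C, eval_pow, eval_X]

theorem integral (hf : HasPolynomialDerivAt f f' s) {A : ℝ → ℝ} (b : ℝ[X])
    (hint : ∀ᶠ t in 𝓝 s, ∀ q : ℝ[X],
      Integrable fun x => q.eval x * exp (-(A x + t * b.eval x))) :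
    HasDerivAt (fun t => ∫ x, (f t).eval x * exp (-(A x + t * b.eval x)))
      ((weightFunctional _ hint.self_of_nhds) (f' - b * f s)) s := by
  set L := weightFunctional _ hint.self_of_nhds
  obtain ⟨N, hN, hN'⟩ := hf.exists_sum
  have h : HasDerivAt
      (fun t => ∑ j ∈ Finset.range N, (f t).coeff j *
        ∫ x, (X ^ j : ℝ[X]).eval x * exp (-(A x + t * b.eval x)))
      (∑ j ∈ Finset.range N, (f'.coeff j * L (X ^ j) + (f s).coeff j * -L (b * X ^ j))) s :=
    HasDerivAt.fun_sum fun j _ =>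
      (hf.coeff j).mul (hasDerivAt_integral_eval_mul_exp b hint (X ^ j))
  have hd : L (f' - b * f s) =
      ∑ j ∈ Finset.range N, (f'.coeff j * L (X ^ j) + (f s).coeff j * -L (b * X ^ j)) := by
    conv_lhs => rw [hN', hN.self_of_nhds]
    simp only [Finset.mul_sum, map_sub, map_sum, mul_left_comm b, L.map_C_mul_polynomial,
      ← Finset.sum_sub_distrib]
    exact Finset.sum_congr rfl fun j _ => by ring
  rw [hd]
  refine h.congr_of_eventuallyEq ?_
  filter_upwards [hN, hint] with t ht hi
  conv_lhs => rw [ht]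
  change weightFunctional _ hi _ = _
  simp only [map_sum, LinearMap.map_C_mul_polynomial]
  rfl

theorem exists_of_monic {n : ℕ} (hmonic : ∀ᶠ t in 𝓝 s, (f t).Monic ∧ (f t).natDegree = n)
    (hd : ∀ j, DifferentiableAt ℝ (fun t => (f t).coeff j) s) :
    ∃ f' : ℝ[X], f'.degree < n ∧ HasPolynomialDerivAt f f' s := by
  set f' : ℝ[X] := ∑ j ∈ Finset.range n, C (deriv (fun t => (f t).coeff j) s) * X ^ j
  have hcoeff : ∀ j, f'.coeff j = if j < n then deriv (fun t => (f t).coeff j) s else 0 := by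
    intro j
    simp [f', coeff_X_pow]
  refine ⟨f', ?_, ?_, n + 1, hmonic.mono fun t ht => by omega⟩
  · rw [degree_lt_iff_coeff_zero]
    intro j hj
    rw [hcoeff, if_neg hj.not_gt]
  · intro j
    rw [hcoeff]
    split_ifs with hj
    · exact (hd j).hasDerivAt
    · refine (hasDerivAt_const s (if j = n then (1 : ℝ) else 0)).congr_of_eventuallyEq ?_
      filter_upwards [hmonic] with t ⟨ht, ht'⟩
      split_ifs with hjn
      · rw [hjn, ← ht', ht.coeff_natDegree]
      · exact coeff_eq_zero_of_natDegree_lt (by omega)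

end HasPolynomialDerivAt

/-- The deformation of the orthogonal polynomials of the weight `exp (-(A + t b))`. -/
theorem IsMonicOrthogonal.eval_deriv_eq {A : ℝ → ℝ} {b : ℝ[X]} {s : ℝ} {P : ℕ → ℝ → ℝ[X]}
    {P' : ℕ → ℝ[X]}
    (hint : ∀ᶠ t in 𝓝 s, ∀ q : ℝ[X],
      Integrable fun x => q.eval x * exp (-(A x + t * b.eval x)))
    (hP : IsMonicOrthogonal (weightFunctional _ hint.self_of_nhds) fun n => P n s)
    (horth : ∀ n m, n ≠ m →
      ∀ᶠ t in 𝓝 s, ∫ x, (P n t * P m t).eval x * exp (-(A x + t * b.eval x)) = 0)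
    (hP' : ∀ n, HasPolynomialDerivAt (P n) (P' n) s) (hdeg : ∀ n, (P' n).degree < n)
    (n : ℕ) (x : ℝ) :
    (P' n).eval x = (weightFunctional _ hint.self_of_nhds) (b * P n s *
      reproducingKernel (weightFunctional _ hint.self_of_nhds) (fun n => P n s) n x) := by
  set L := weightFunctional _ hint.self_of_nhds
  rw [← hP.map_mul_reproducingKernel_eq_eval (hdeg n), map_mul_reproducingKernel,
    map_mul_reproducingKernel]
  refine Finset.sum_congr rfl fun m hm => ?_
  have hmn := Finset.mem_range.1 hm
  have h0 := (((hP' n).mul (hP' m)).integral b hint).unique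
    ((hasDerivAt_const s (0 : ℝ)).congr_of_eventuallyEq (horth n m hmn.ne'))
  have h1 : L (P n s * P' m) = 0 := by
    rw [mul_comm]
    exact hP.map_mul_eq_zero ((hdeg m).trans (by exact_mod_cast hmn))
  rw [map_sub, map_add, h1, add_zero, sub_eq_zero, ← mul_assoc] at h0
  rw [h0]

/-- The deformation of the square norms of the orthogonal polynomials. -/
theorem IsMonicOrthogonal.hasDerivAt_norm {A : ℝ → ℝ} {b : ℝ[X]} {s : ℝ} {P : ℕ → ℝ → ℝ[X]}
    {P' : ℕ → ℝ[X]}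
    (hint : ∀ᶠ t in 𝓝 s, ∀ q : ℝ[X],
      Integrable fun x => q.eval x * exp (-(A x + t * b.eval x)))
    (hP : IsMonicOrthogonal (weightFunctional _ hint.self_of_nhds) fun n => P n s)
    (hP' : ∀ n, HasPolynomialDerivAt (P n) (P' n) s) (hdeg : ∀ n, (P' n).degree < n) (n : ℕ) :
    HasDerivAt (fun t => ∫ x, (P n t * P n t).eval x * exp (-(A x + t * b.eval x)))
      (-(weightFunctional _ hint.self_of_nhds) (b * (P n s * P n s))) s := by
  refine (((hP' n).mul (hP' n)).integral b hint).congr_deriv ?_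
  rw [mul_comm (P n s) (P' n), map_sub, map_add, hP.map_mul_eq_zero (hdeg n)]
  ring

end ExponentialWeight

theorem stmt14
    (D : ℕ) (hDeven : Even D) (hD2 : 2 ≤ D)
    (U : Set (Fin D → ℝ)) (hUopen : IsOpen U)
    (hUpos : ∀ u ∈ U, 0 < u ⟨D - 1, by omega⟩)
    (Vf : (Fin D → ℝ) → ℝ → ℝ)
    (hVf : ∀ (u : Fin D → ℝ) (x : ℝ),
      Vf u x = ∑ i : Fin D, u i / ((i : ℕ) + 1) * x ^ ((i : ℕ) + 1))
    (hint : ∀ u ∈ U, ∀ q : Polynomial ℝ,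
      Integrable (fun x : ℝ => q.eval x * Real.exp (-(Vf u x))))
    (p : (Fin D → ℝ) → ℕ → Polynomial ℝ)
    (hmonic : ∀ u ∈ U, ∀ n, (p u n).Monic)
    (hpdeg : ∀ u ∈ U, ∀ n, (p u n).natDegree = n)
    (horth : ∀ u ∈ U, ∀ n m, n ≠ m →
      ∫ x : ℝ, (p u n).eval x * (p u m).eval x * Real.exp (-(Vf u x)) = 0)
    (h : (Fin D → ℝ) → ℕ → ℝ)
    (hh : ∀ (u : Fin D → ℝ) (n : ℕ),
      h u n = ∫ x : ℝ, ((p u n).eval x) ^ 2 * Real.exp (-(Vf u x)))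
    (hhpos : ∀ u ∈ U, ∀ n, 0 < h u n)
    (ψ : (Fin D → ℝ) → ℕ → ℝ → ℝ)
    (hψ : ∀ (u : Fin D → ℝ) (n : ℕ) (x : ℝ),
      ψ u n x = (p u n).eval x * Real.exp (-(Vf u x) / 2) / Real.sqrt (h u n))
    (hcoeff : ∀ n j, DifferentiableOn ℝ (fun u => (p u n).coeff j) U)
    (γ : (Fin D → ℝ) → ℕ → ℝ)
    (hγ : ∀ (u : Fin D → ℝ) (n : ℕ), 1 ≤ n → γ u n = Real.sqrt (h u n / h u (n - 1)))
    (M : (Fin D → ℝ) → ℕ → ℕ → ℕ → ℝ)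
    (hM : ∀ (u : Fin D → ℝ) (k a b : ℕ),
      M u k a b = ∫ t : ℝ, t ^ k * ψ u a t * ψ u b t)
    (T : (Fin D → ℝ) → ℕ → ℕ → ℕ → ℝ → ℝ)
    (hT : ∀ (u : Fin D → ℝ) (k a b : ℕ) (x : ℝ),
      T u k a b x = ∫ t : ℝ, (∑ j ∈ Finset.range k, x ^ j * t ^ (k - 1 - j)) * ψ u a t * ψ u b t)
    (u : Fin D → ℝ) (hu : u ∈ U) (i : Fin D) (n : ℕ) (hn : 1 ≤ n) (x : ℝ) :
    HasDerivAt (fun t => ψ (Function.update u i t) (n - 1) x)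
      (((x ^ ((i : ℕ) + 1) - M u ((i : ℕ) + 1) (n - 1) (n - 1))
            / (2 * ((i : ℕ) + 1 : ℝ))
          + γ u n / ((i : ℕ) + 1 : ℝ) * T u ((i : ℕ) + 1) n (n - 1) x)
          * ψ u (n - 1) x
        - γ u n / ((i : ℕ) + 1 : ℝ) * T u ((i : ℕ) + 1) (n - 1) (n - 1) x * ψ u n x)
      (u i) ∧
    HasDerivAt (fun t => ψ (Function.update u i t) n x)
      (γ u n / ((i : ℕ) + 1 : ℝ) * T u ((i : ℕ) + 1) n n x * ψ u (n - 1) x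
        + ((M u ((i : ℕ) + 1) n n - x ^ ((i : ℕ) + 1)) / (2 * ((i : ℕ) + 1 : ℝ))
            - γ u n / ((i : ℕ) + 1 : ℝ) * T u ((i : ℕ) + 1) n (n - 1) x)
          * ψ u n x)
      (u i) := by
  set k := (i : ℕ) + 1
  have hk0 : ((i : ℕ) + 1 : ℝ) ≠ 0 := by positivity
  set κ : ℝ := (i : ℕ) + 1
  set b : ℝ[X] := C (1 / κ) * X ^ k with hb
  set A : ℝ → ℝ := fun y => Vf u y - u i * b.eval y with hA
  have hbev : ∀ y, b.eval y = 1 / κ * y ^ k := fun y => by simp [hb]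
  have hV : ∀ t y, Vf (Function.update u i t) y = A y + t * b.eval y := by
    intro t y
    simp only [hA, hVf]
    rw [← Finset.add_sum_erase _ _ (Finset.mem_univ i),
      ← Finset.add_sum_erase _ _ (Finset.mem_univ i), Function.update_self, hbev,
      Finset.sum_congr rfl fun j hj => by
        rw [Function.update_of_ne (Finset.ne_of_mem_erase hj)]]
    ring
  have hVu : ∀ y, A y + u i * b.eval y = Vf u y := fun y => by simp only [hA]; ring
  have hUev : ∀ᶠ t in nhds (u i), Function.update u i t ∈ U := by
    have hc : ContinuousAt (Function.update u i) (u i) :=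
      (continuous_const.update i continuous_id).continuousAt
    refine hc.eventually_mem (hUopen.mem_nhds ?_)
    rwa [Function.update_eq_self]
  have hint' : ∀ᶠ t in nhds (u i), ∀ q : ℝ[X],
      Integrable fun y => q.eval y * exp (-(A y + t * b.eval y)) := by
    filter_upwards [hUev] with t ht
    simpa only [hV] using hint _ ht
  set L := weightFunctional _ hint'.self_of_nhds with hL
  have hLapp : ∀ q, L q = ∫ y, q.eval y * exp (-(Vf u y)) := fun q => by
    simp only [← hVu]
    rfl
  set P : ℕ → ℝ → ℝ[X] := fun n t => p (Function.update u i t) n with hPdef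
  have hPu : ∀ n, P n (u i) = p u n := fun n => by
    simp only [hPdef, Function.update_eq_self]
  have hh' : ∀ n, L (p u n * p u n) = h u n := fun n => by
    rw [hLapp, hh]
    simp only [eval_mul, pow_two]
  have hP : IsMonicOrthogonal L fun n => P n (u i) := by
    simp only [hPu]
    refine ⟨hmonic u hu, hpdeg u hu, fun n m hnm => ?_, fun n => ?_⟩
    · simpa only [hLapp, eval_mul] using horth u hu n m hnm
    · rw [hh']
      exact (hhpos u hu n).ne'
  have horth' : ∀ n m, n ≠ m → ∀ᶠ t in nhds (u i),
      ∫ y, (P n t * P m t).eval y * exp (-(A y + t * b.eval y)) = 0 := by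
    intro n m hnm
    filter_upwards [hUev] with t ht
    simpa only [eval_mul, hV] using horth _ ht n m hnm
  have hex : ∀ n : ℕ, ∃ f' : ℝ[X], f'.degree < n ∧ HasPolynomialDerivAt (P n) f' (u i) := by
    intro n
    refine HasPolynomialDerivAt.exists_of_monic ?_ fun j => ?_
    · filter_upwards [hUev] with t ht using ⟨hmonic _ ht n, hpdeg _ ht n⟩
    · have h1 : DifferentiableAt ℝ (fun v => (p v n).coeff j) (Function.update u i (u i)) := by
        rw [Function.update_eq_self]
        exact (hcoeff n j).differentiableAt (hUopen.mem_nhds hu)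
      exact h1.comp (u i) (hasDerivAt_update u i (u i)).differentiableAt
  choose P' hdeg hP' using hex
  have heval := hP.eval_deriv_eq hint' horth' hP' hdeg
  have hnorm := hP.hasDerivAt_norm hint' hP' hdeg
  rw [← hL] at heval hnorm
  simp only [hPu] at heval hnorm hP
  have hbL : ∀ q, L (b * q) = 1 / κ * L (X ^ k * q) := fun q => by
    rw [hb, mul_assoc, L.map_C_mul_polynomial]
  have hψ' : ∀ n, HasDerivAt (fun t => ψ (Function.update u i t) n x)
      (exp (-(Vf u x) / 2) / √(h u n) * ((P' n).eval x +
        (L (X ^ k * (p u n * p u n)) / h u n - x ^ k) / (2 * κ) * (p u n).eval x)) (u i) := by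
    intro n
    have hpos := hhpos u hu n
    have hsq : √(h u n) ≠ 0 := (Real.sqrt_pos.2 hpos).ne'
    have e1 := (hP' n).eval x
    have e2 : HasDerivAt (fun t => exp (-(A x + t * b.eval x) / 2))
        (exp (-(A x + u i * b.eval x) / 2) * (-b.eval x / 2)) (u i) := by
      simpa using
        (((hasDerivAt_id (u i)).mul_const (b.eval x)).const_add (A x)).fun_neg.div_const 2 |>.exp
    have e3 : HasDerivAt (fun t => h (Function.update u i t) n)
        (-(1 / κ * L (X ^ k * (p u n * p u n)))) (u i) := by
      rw [← hbL]
      refine (hnorm n).congr_of_eventuallyEq (Filter.Eventually.of_forall fun t => ?_)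
      simp only [hh, hV, eval_mul, pow_two, hPdef]
    have e4 := ((e1.mul e2).div (e3.sqrt (by
      rw [Function.update_eq_self]
      exact hpos.ne')) (by rwa [Function.update_eq_self]))
    refine (e4.congr_of_eventuallyEq (Filter.Eventually.of_forall fun t => ?_)).congr_deriv ?_
    · simp only [hψ, hV, hPdef, Pi.mul_apply, Pi.div_apply]
    · rw [Pi.mul_apply]
      simp only [Function.update_eq_self, hVu, hPu]
      rw [hbev]
      have hs2 : h u n = √(h u n) ^ 2 := (Real.sq_sqrt hpos.le).symm
      generalize √(h u n) = r at hsq hs2 ⊢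
      rw [hs2]
      field_simp
      ring
  have hψL : ∀ (q : ℝ[X]) (a c : ℕ), ∫ t, q.eval t * ψ u a t * ψ u c t =
      L (q * (p u a * p u c)) / (√(h u a) * √(h u c)) := by
    intro q a c
    rw [hLapp, ← integral_div]
    refine integral_congr_ae (Filter.Eventually.of_forall fun t => ?_)
    have : exp (-(Vf u t)) = exp (-(Vf u t) / 2) * exp (-(Vf u t) / 2) := by
      rw [← exp_add, add_halves]
    simp only [hψ, eval_mul, this]
    ring
  have hM' : ∀ a c, M u k a c = L (X ^ k * (p u a * p u c)) / (√(h u a) * √(h u c)) := by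
    intro a c
    rw [hM, ← hψL]
    simp only [eval_pow, eval_X]
  set S : ℝ[X] := ∑ j ∈ Finset.range k, C x ^ j * X ^ (k - 1 - j) with hS
  have hT' : ∀ a c, T u k a c x = L (S * (p u a * p u c)) / (√(h u a) * √(h u c)) := by
    intro a c
    rw [hT, ← hψL]
    simp only [hS, eval_finsetSum, eval_mul, eval_pow, eval_X, eval_C]
  obtain ⟨m, rfl⟩ : ∃ m, n = m + 1 := ⟨n - 1, by omega⟩
  have hkernel : ∀ f, _ := fun f => hP.map_X_pow_mul_reproducingKernel m k x f
  have hd1 := heval (m + 1) x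
  have hd0 := heval m x
  have hself := hP.map_mul_reproducingKernel_self (m + 1) x
  have hsucc := map_mul_reproducingKernel_succ L (p u) m x (X ^ k * p u m)
  have hrepr := hP.map_mul_reproducingKernel_eq_eval
    (show (p u m).degree < (m + 1 : ℕ) by
      rw [hP.degree_eq]
      exact_mod_cast m.lt_succ_self) x
  rw [mul_assoc, hbL, ← mul_assoc, hkernel, hself, ← hS, hh'] at hd1
  rw [mul_assoc, hbL, ← mul_assoc] at hd0
  rw [hkernel, hrepr, ← hS, hh', mul_assoc _ (p u m) (p u m)] at hsucc
  have hm := hhpos u hu m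
  have hm1 := hhpos u hu (m + 1)
  rw [add_tsub_cancel_right, hγ u (m + 1) hn, add_tsub_cancel_right, Real.sqrt_div hm1.le, hM', hM',
    hT', hT', hT', hψ, hψ]
  have hr : √(h u m) ≠ 0 := (Real.sqrt_pos.2 hm).ne'
  have hr1 : √(h u (m + 1)) ≠ 0 := (Real.sqrt_pos.2 hm1).ne'
  have hs : h u m = √(h u m) ^ 2 := (Real.sq_sqrt hm.le).symm
  have hs1 : h u (m + 1) = √(h u (m + 1)) ^ 2 := (Real.sq_sqrt hm1.le).symm
  have hcomm : p u m * p u (m + 1) = p u (m + 1) * p u m := mul_comm _ _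
  rw [hcomm] at hsucc
  refine ⟨(hψ' m).congr_deriv ?_, (hψ' (m + 1)).congr_deriv ?_⟩
  · rw [hd0, eq_sub_of_add_eq hsucc.symm]
    generalize √(h u m) = r at hr hs ⊢
    generalize √(h u (m + 1)) = r₁ at hr1 hs1 ⊢
    rw [hs]
    field_simp
    ring
  · rw [hd1]
    generalize √(h u m) = r at hr hs ⊢
    generalize √(h u (m + 1)) = r₁ at hr1 hs1 ⊢
    rw [hs, hs1]
    field_simp
    ring
end
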